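/- Let 1 ≤ m < n, β > 0, u(z',z'') = (1+|z'|²)|z''|^{2β} on ℂ^m × ℂ^{n−m}, and N = {z : z'' = 0}. For z ∈ ℂⁿ ∖ N define φ(z) = (1/2)[ |z''|² + β²(1+|z'|²) + √( (|z''|² + β²(1+|z'|²))² − 4β²|z''|² ) ]. Then the multiset of eigenvalues (with multiplicity) of the complex Hessian (D²_ℂ u)(z) consists of: |z''|^{2β} with multiplicity m−1; β(1+|z'|²)|z''|^{2β−2} with multiplicity n−m−1; φ(z)|z''|^{2β−2}; and (β²/φ(z))|z''|^{2β}. -/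

import Mathlib

open scoped ComplexOrder

noncomputable section

/-- The direction `∂/∂xᵢ` in `ℂⁿ`. -/
def ex {n : ℕ} (i : Fin n) : Fin n → ℂ := Pi.single i 1
/-- The direction `∂/∂yᵢ` in `ℂⁿ`. -/
def ey {n : ℕ} (i : Fin n) : Fin n → ℂ := Pi.single i Complex.I

/-- Second directional (real) derivative `∂_v ∂_w u`. -/
def dd2 {n : ℕ} (u : (Fin n → ℂ) → ℝ) (z v w : Fin n → ℂ) : ℝ :=
  fderiv ℝ (fun y => fderiv ℝ u y w) z v

/-- The complex Hessian `(∂²u/∂zᵢ∂z̄ⱼ)_{i,j}`, expressed through real second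
derivatives: `∂²u/∂zᵢ∂z̄ⱼ = (1/4)[∂xᵢ∂xⱼu + ∂yᵢ∂yⱼu + i(∂xᵢ∂yⱼu − ∂yᵢ∂xⱼu)]`. -/
def complexHessian {n : ℕ} (u : (Fin n → ℂ) → ℝ) (z : Fin n → ℂ) :
    Matrix (Fin n) (Fin n) ℂ :=
  Matrix.of fun i j =>
    (((dd2 u z (ex i) (ex j) + dd2 u z (ey i) (ey j) : ℝ) : ℂ)
      + Complex.I * ((dd2 u z (ex i) (ey j) - dd2 u z (ey i) (ex j) : ℝ) : ℂ)) / 4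

/-- `|z'|²`: squared norm of the first `m` coordinates. -/
def nsqFirst {n : ℕ} (m : ℕ) (z : Fin n → ℂ) : ℝ :=
  ∑ i ∈ Finset.univ.filter (fun i : Fin n => (i : ℕ) < m), Complex.normSq (z i)

/-- `|z''|²`: squared norm of the last `n − m` coordinates. -/
def nsqLast {n : ℕ} (m : ℕ) (z : Fin n → ℂ) : ℝ :=
  ∑ i ∈ Finset.univ.filter (fun i : Fin n => m ≤ (i : ℕ)), Complex.normSq (z i)

/-- The Pogorelov-type example `u(z',z'') = (1+|z'|²)·|z''|^{2β}`. -/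
def pogorelov {n : ℕ} (m : ℕ) (β : ℝ) (z : Fin n → ℂ) : ℝ :=
  (1 + nsqFirst m z) * Real.sqrt (nsqLast m z) ^ (2 * β)

/-- The singular set `N = {z : z'' = 0}`. -/
def singSet (n m : ℕ) : Set (Fin n → ℂ) := {z | ∀ i : Fin n, m ≤ (i : ℕ) → z i = 0}


/-- The multiset of eigenvalues (with multiplicity) of a Hermitian matrix
(junk value `0` if the matrix is not Hermitian). -/
def eigMultiset {n : ℕ} (A : Matrix (Fin n) (Fin n) ℂ) : Multiset ℝ :=
  if h : A.IsHermitian then Multiset.map h.eigenvalues Finset.univ.val else 0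

/-- The real derivative at `y` of `y ↦ ∑ i ∈ S, |yᵢ|²`. -/
def nsqDeriv {n : ℕ} (S : Finset (Fin n)) (y : Fin n → ℂ) : (Fin n → ℂ) →L[ℝ] ℝ :=
  ∑ i ∈ S, (2 : ℝ) • ((y i).re • Complex.reCLM.comp (ContinuousLinearMap.proj i)
    + (y i).im • Complex.imCLM.comp (ContinuousLinearMap.proj i))

lemma nsqDeriv_apply {n : ℕ} (S : Finset (Fin n)) (y w : Fin n → ℂ) :
    nsqDeriv S y w = ∑ i ∈ S, 2 * ((y i).re * (w i).re + (y i).im * (w i).im) := by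
  simp [nsqDeriv, mul_add]

lemma nsqDeriv_comm {n : ℕ} (S : Finset (Fin n)) (y w : Fin n → ℂ) :
    nsqDeriv S y w = nsqDeriv S w y := by
  simp only [nsqDeriv_apply]
  exact Finset.sum_congr rfl fun i _ => by ring

lemma hasFDerivAt_sum_normSq {n : ℕ} (S : Finset (Fin n)) (y : Fin n → ℂ) :
    HasFDerivAt (fun y : Fin n → ℂ => ∑ i ∈ S, Complex.normSq (y i)) (nsqDeriv S y) y := by
  unfold nsqDeriv
  refine HasFDerivAt.fun_sum fun i _ => ?_
  have hre : HasFDerivAt (fun y : Fin n → ℂ => (y i).re)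
      (Complex.reCLM.comp (ContinuousLinearMap.proj i : (Fin n → ℂ) →L[ℝ] ℂ)) y :=
    (Complex.reCLM.comp (ContinuousLinearMap.proj i : (Fin n → ℂ) →L[ℝ] ℂ)).hasFDerivAt
  have him : HasFDerivAt (fun y : Fin n → ℂ => (y i).im)
      (Complex.imCLM.comp (ContinuousLinearMap.proj i : (Fin n → ℂ) →L[ℝ] ℂ)) y :=
    (Complex.imCLM.comp (ContinuousLinearMap.proj i : (Fin n → ℂ) →L[ℝ] ℂ)).hasFDerivAt
  simp only [Complex.normSq_apply]
  refine ((hre.mul hre).add (him.mul him)).congr_fderiv ?_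
  ext w
  simp
  ring

lemma hasFDerivAt_nsqDeriv_apply {n : ℕ} (S : Finset (Fin n)) (z w : Fin n → ℂ) :
    HasFDerivAt (fun y => nsqDeriv S y w) (nsqDeriv S w) z := by
  simp only [nsqDeriv_comm S _ w]
  exact (nsqDeriv S w).hasFDerivAt

/-- The indices of the first `m` coordinates. -/
abbrev firstIdx (n m : ℕ) : Finset (Fin n) := Finset.univ.filter fun i => (i : ℕ) < m

/-- The indices of the last `n - m` coordinates. -/
abbrev lastIdx (n m : ℕ) : Finset (Fin n) := Finset.univ.filter fun i => m ≤ (i : ℕ)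

lemma hasFDerivAt_nsqFirst {n : ℕ} (m : ℕ) (y : Fin n → ℂ) :
    HasFDerivAt (nsqFirst m) (nsqDeriv (firstIdx n m) y) y :=
  hasFDerivAt_sum_normSq _ y

lemma hasFDerivAt_nsqLast {n : ℕ} (m : ℕ) (y : Fin n → ℂ) :
    HasFDerivAt (nsqLast m) (nsqDeriv (lastIdx n m) y) y :=
  hasFDerivAt_sum_normSq _ y

lemma nsqFirst_nonneg {n : ℕ} (m : ℕ) (z : Fin n → ℂ) : 0 ≤ nsqFirst m z :=
  Finset.sum_nonneg fun _ _ => Complex.normSq_nonneg _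

lemma nsqLast_nonneg {n : ℕ} (m : ℕ) (z : Fin n → ℂ) : 0 ≤ nsqLast m z :=
  Finset.sum_nonneg fun _ _ => Complex.normSq_nonneg _

lemma nsqLast_pos {n m : ℕ} {z : Fin n → ℂ} (hz : z ∉ singSet n m) : 0 < nsqLast m z := by
  simp only [singSet, Set.mem_ofPred_eq, not_forall] at hz
  obtain ⟨i, hi, hzi⟩ := hz
  exact Finset.sum_pos' (fun _ _ => Complex.normSq_nonneg _)
    ⟨i, by simpa using hi, Complex.normSq_pos.2 hzi⟩

lemma sqrt_rpow_two_mul {s : ℝ} (hs : 0 ≤ s) (b : ℝ) : Real.sqrt s ^ (2 * b) = s ^ b := by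
  rw [Real.sqrt_eq_rpow, ← Real.rpow_mul hs]
  ring_nf

lemma pogorelov_eq {n : ℕ} (m : ℕ) (β : ℝ) :
    pogorelov (n := n) m β = fun z => (1 + nsqFirst m z) * nsqLast m z ^ β := by
  funext z
  rw [pogorelov, sqrt_rpow_two_mul (nsqLast_nonneg m z)]

lemma fderiv_pogorelov_apply {n m : ℕ} (β : ℝ) {y : Fin n → ℂ} (hy : nsqLast m y ≠ 0)
    (w : Fin n → ℂ) :
    fderiv ℝ (pogorelov m β) y w =
      nsqDeriv (firstIdx n m) y w * nsqLast m y ^ β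
      + (1 + nsqFirst m y) * (β * nsqLast m y ^ (β - 1) * nsqDeriv (lastIdx n m) y w) := by
  have h := ((hasFDerivAt_nsqFirst m y).const_add 1).mul
    ((hasFDerivAt_nsqLast m y).rpow_const (p := β) (Or.inl hy))
  rw [pogorelov_eq]
  have h' : HasFDerivAt (fun z : Fin n → ℂ => (1 + nsqFirst m z) * nsqLast m z ^ β) _ y := h
  rw [h'.fderiv]
  simp
  ring

lemma dd2_pogorelov {n m : ℕ} (β : ℝ) {z : Fin n → ℂ} (hz : 0 < nsqLast m z)
    (v w : Fin n → ℂ) :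
    dd2 (pogorelov m β) z v w =
      nsqLast m z ^ β * nsqDeriv (firstIdx n m) v w
      + (1 + nsqFirst m z) * (β * nsqLast m z ^ (β - 1)) * nsqDeriv (lastIdx n m) v w
      + β * nsqLast m z ^ (β - 1)
        * (nsqDeriv (firstIdx n m) z v * nsqDeriv (lastIdx n m) z w
          + nsqDeriv (firstIdx n m) z w * nsqDeriv (lastIdx n m) z v)
      + (1 + nsqFirst m z) * (β * ((β - 1) * nsqLast m z ^ (β - 2)))
        * (nsqDeriv (lastIdx n m) z v * nsqDeriv (lastIdx n m) z w) := by
  have hev : (fun y => fderiv ℝ (pogorelov m β) y w) =ᶠ[nhds z] fun y =>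
      nsqDeriv (firstIdx n m) y w * nsqLast m y ^ β
      + (1 + nsqFirst m y) * (β * nsqLast m y ^ (β - 1) * nsqDeriv (lastIdx n m) y w) := by
    filter_upwards [(hasFDerivAt_nsqLast m z).continuousAt.eventually_ne hz.ne'] with y hy
    exact fderiv_pogorelov_apply β hy w
  have hs := hasFDerivAt_nsqLast m z
  have ha := (hasFDerivAt_nsqFirst m z).const_add 1
  have h := ((hasFDerivAt_nsqDeriv_apply (firstIdx n m) z w).mul
      (hs.rpow_const (p := β) (Or.inl hz.ne'))).add
    (ha.mul (((hs.rpow_const (p := β - 1) (Or.inl hz.ne')).const_mul β).mul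
      (hasFDerivAt_nsqDeriv_apply (lastIdx n m) z w)))
  have h' : HasFDerivAt (fun y =>
      nsqDeriv (firstIdx n m) y w * nsqLast m y ^ β
      + (1 + nsqFirst m y) * (β * nsqLast m y ^ (β - 1) * nsqDeriv (lastIdx n m) y w)) _ z := h
  rw [dd2, hev.fderiv_eq, h'.fderiv, nsqDeriv_comm _ v w, nsqDeriv_comm _ v w]
  have h2 : β - 1 - 1 = β - 2 := by ring
  simp [h2]
  ring

lemma nsqDeriv_ex {n : ℕ} (S : Finset (Fin n)) (z : Fin n → ℂ) (i : Fin n) :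
    nsqDeriv S z (ex i) = if i ∈ S then 2 * (z i).re else 0 := by
  rw [nsqDeriv_apply, ← Finset.sum_ite_eq S i (fun j => 2 * (z j).re)]
  refine Finset.sum_congr rfl fun j _ => ?_
  by_cases h : i = j
  · subst h; simp [ex]
  · simp [ex, h, Ne.symm h]

lemma nsqDeriv_ey {n : ℕ} (S : Finset (Fin n)) (z : Fin n → ℂ) (i : Fin n) :
    nsqDeriv S z (ey i) = if i ∈ S then 2 * (z i).im else 0 := by
  rw [nsqDeriv_apply, ← Finset.sum_ite_eq S i (fun j => 2 * (z j).im)]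
  refine Finset.sum_congr rfl fun j _ => ?_
  by_cases h : i = j
  · subst h; simp [ey]
  · simp [ey, h, Ne.symm h]

/-- The conjugate of the vector `z'`, extended by zero. -/
def conjFirst {n : ℕ} (m : ℕ) (z : Fin n → ℂ) (i : Fin n) : ℂ :=
  if (i : ℕ) < m then star (z i) else 0

/-- The conjugate of the vector `z''`, extended by zero. -/
def conjLast {n : ℕ} (m : ℕ) (z : Fin n → ℂ) (i : Fin n) : ℂ :=
  if (i : ℕ) < m then 0 else star (z i)

/-- The matrix `diag(A, B) + c (p q* + q p*) + e q q*`, where `p` and `q` are the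
conjugates of `z'` and `z''`. -/
def blockModel {n : ℕ} (m : ℕ) (z : Fin n → ℂ) (A B c e : ℝ) : Matrix (Fin n) (Fin n) ℂ :=
  Matrix.diagonal (fun i : Fin n => if (i : ℕ) < m then (A : ℂ) else B)
  + Matrix.of fun i j =>
      c * (conjFirst m z i * star (conjLast m z j) + conjLast m z i * star (conjFirst m z j))
      + e * (conjLast m z i * star (conjLast m z j))

lemma complexHessian_pogorelov {n m : ℕ} (β : ℝ) {z : Fin n → ℂ} (hz : 0 < nsqLast m z) :
    complexHessian (pogorelov m β) z =
      blockModel m z (nsqLast m z ^ β) ((1 + nsqFirst m z) * (β * nsqLast m z ^ (β - 1)))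
        (β * nsqLast m z ^ (β - 1))
        ((1 + nsqFirst m z) * (β * ((β - 1) * nsqLast m z ^ (β - 2)))) := by
  ext i j
  simp only [complexHessian, Matrix.of_apply, dd2_pogorelov β hz, nsqDeriv_ex, nsqDeriv_ey,
    blockModel, Matrix.add_apply, Matrix.diagonal_apply, conjFirst, conjLast,
    Finset.mem_filter, Finset.mem_univ, true_and]
  generalize nsqLast m z ^ β = A
  generalize (1 + nsqFirst m z) * (β * nsqLast m z ^ (β - 1)) = B
  generalize β * nsqLast m z ^ (β - 1) = c
  generalize (1 + nsqFirst m z) * (β * ((β - 1) * nsqLast m z ^ (β - 2))) = e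
  by_cases hij : i = j
  · subst hij
    by_cases hi : (i : ℕ) < m
    · have hi' : ¬ m ≤ (i : ℕ) := by omega
      apply Complex.ext <;> simp [hi, hi', ex, ey]
      ring
    · have hi' : m ≤ (i : ℕ) := by omega
      apply Complex.ext <;> simp [hi, hi', ex, ey] <;> ring
  · by_cases hi : (i : ℕ) < m <;> by_cases hj : (j : ℕ) < m
    · have hi' : ¬ m ≤ (i : ℕ) := by omega
      have hj' : ¬ m ≤ (j : ℕ) := by omega
      apply Complex.ext <;> simp [hi, hi', hj, hj', hij, Ne.symm hij, ex, ey]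
    · have hi' : ¬ m ≤ (i : ℕ) := by omega
      have hj' : m ≤ (j : ℕ) := by omega
      apply Complex.ext <;> simp [hi, hi', hj, hj', hij, Ne.symm hij, ex, ey] <;> ring
    · have hi' : m ≤ (i : ℕ) := by omega
      have hj' : ¬ m ≤ (j : ℕ) := by omega
      apply Complex.ext <;> simp [hi, hi', hj, hj', hij, Ne.symm hij, ex, ey] <;> ring
    · have hi' : m ≤ (i : ℕ) := by omega
      have hj' : m ≤ (j : ℕ) := by omega
      apply Complex.ext <;> simp [hi, hi', hj, hj', hij, Ne.symm hij, ex, ey] <;> ring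

lemma blockModel_isHermitian {n : ℕ} (m : ℕ) (z : Fin n → ℂ) (A B c e : ℝ) :
    (blockModel m z A B c e).IsHermitian := by
  refine Matrix.IsHermitian.add (Matrix.isHermitian_diagonal_of_self_adjoint _ ?_) ?_
  · funext i
    by_cases hi : (i : ℕ) < m <;> simp [hi]
  · ext i j
    simp
    ring

lemma sum_star_conjFirst_mul {n : ℕ} (m : ℕ) (z : Fin n → ℂ) (a : ℂ) :
    ∑ i, star (conjFirst m z i) * (a * conjFirst m z i) = a * nsqFirst m z := by
  rw [nsqFirst, Finset.sum_filter, Complex.ofReal_sum, Finset.mul_sum]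
  refine Finset.sum_congr rfl fun i _ => ?_
  by_cases hi : (i : ℕ) < m
  · simp [conjFirst, hi, Complex.normSq_eq_conj_mul_self]; ring
  · simp [conjFirst, hi]

lemma sum_star_conjLast_mul {n : ℕ} (m : ℕ) (z : Fin n → ℂ) (a : ℂ) :
    ∑ i, star (conjLast m z i) * (a * conjLast m z i) = a * nsqLast m z := by
  rw [nsqLast, Finset.sum_filter, Complex.ofReal_sum, Finset.mul_sum]
  refine Finset.sum_congr rfl fun i _ => ?_
  by_cases hi : (i : ℕ) < m
  · simp [conjLast, hi, Nat.not_le.2 hi]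
  · simp [conjLast, hi, Nat.not_lt.1 hi, Complex.normSq_eq_conj_mul_self]; ring

lemma prod_ite_val_lt {n m : ℕ} (hmn : m ≤ n) (a b : ℂ) :
    ∏ i : Fin n, (if (i : ℕ) < m then a else b) = a ^ m * b ^ (n - m) := by
  obtain ⟨k, rfl⟩ := Nat.exists_eq_add_of_le hmn
  simp [Fin.prod_univ_add]

lemma det_sub_blockModel {n m : ℕ} (hmn : m ≤ n) (z : Fin n → ℂ) (A B c e : ℝ) (x : ℂ)
    (hA : x - A ≠ 0) (hB : x - B ≠ 0) :
    (Matrix.scalar (Fin n) x - blockModel m z A B c e).det =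
      (x - A) ^ m * (x - B) ^ (n - m)
        * (1 - e * nsqLast m z / (x - B)
          - c ^ 2 * nsqFirst m z * nsqLast m z / ((x - A) * (x - B))) := by
  set d : Fin n → ℂ := fun i => if (i : ℕ) < m then x - A else x - B with hd
  have hd0 : ∀ i, d i ≠ 0 := fun i => by by_cases hi : (i : ℕ) < m <;> simp [hd, hi, hA, hB]
  let U : Matrix (Fin n) (Fin 2) ℂ :=
    Matrix.of fun i => ![(d i)⁻¹ * conjFirst m z i, (d i)⁻¹ * conjLast m z i]
  let V : Matrix (Fin 2) (Fin n) ℂ :=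
    Matrix.of ![fun j => c * star (conjLast m z j),
      fun j => c * star (conjFirst m z j) + e * star (conjLast m z j)]
  have hfac : Matrix.scalar (Fin n) x - blockModel m z A B c e
      = Matrix.diagonal d * (1 - U * V) := by
    ext i j
    rw [Matrix.diagonal_mul]
    simp only [blockModel, Matrix.sub_apply, Matrix.add_apply, Matrix.of_apply,
      Matrix.scalar_apply, Matrix.mul_apply, Fin.sum_univ_two, U, V, Matrix.cons_val_zero,
      Matrix.cons_val_one, Matrix.diagonal_apply, Matrix.one_apply]
    have := hd0 i
    field_simp
    by_cases hij : i = j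
    · subst hij
      by_cases hi : (i : ℕ) < m <;> simp [hd, hi] <;> ring
    · simp [hij]; ring
  have hP : ∀ i, (d i)⁻¹ * conjFirst m z i = (x - A)⁻¹ * conjFirst m z i := fun i => by
    by_cases hi : (i : ℕ) < m <;> simp [hd, hi, conjFirst]
  have hQ : ∀ i, (d i)⁻¹ * conjLast m z i = (x - B)⁻¹ * conjLast m z i := fun i => by
    by_cases hi : (i : ℕ) < m <;> simp [hd, hi, conjLast]
  have hPQ : ∀ i, star (conjFirst m z i) * conjLast m z i = 0 := fun i => by
    by_cases hi : (i : ℕ) < m <;> simp [hi, conjFirst, conjLast]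
  have hQP : ∀ i, star (conjLast m z i) * conjFirst m z i = 0 := fun i => by
    by_cases hi : (i : ℕ) < m <;> simp [hi, conjFirst, conjLast]
  have h00 : (V * U) 0 0 = 0 := by
    simp only [Matrix.mul_apply, U, V, Matrix.of_apply, Matrix.cons_val_zero]
    exact Finset.sum_eq_zero fun i _ => by linear_combination c * (d i)⁻¹ * hQP i
  have h01 : (V * U) 0 1 = c * ((x - B)⁻¹ * nsqLast m z) := by
    simp only [Matrix.mul_apply, U, V, Matrix.of_apply, Matrix.cons_val_zero,
      Matrix.cons_val_one, hQ]
    rw [← sum_star_conjLast_mul, Finset.mul_sum]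
    exact Finset.sum_congr rfl fun i _ => by ring
  have h10 : (V * U) 1 0 = c * ((x - A)⁻¹ * nsqFirst m z) := by
    simp only [Matrix.mul_apply, U, V, Matrix.of_apply, Matrix.cons_val_zero,
      Matrix.cons_val_one, hP]
    rw [← sum_star_conjFirst_mul, Finset.mul_sum]
    exact Finset.sum_congr rfl fun i _ => by linear_combination e * (x - A)⁻¹ * hQP i
  have h11 : (V * U) 1 1 = e * ((x - B)⁻¹ * nsqLast m z) := by
    simp only [Matrix.mul_apply, U, V, Matrix.of_apply, Matrix.cons_val_zero,
      Matrix.cons_val_one, hQ]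
    rw [← sum_star_conjLast_mul, Finset.mul_sum]
    exact Finset.sum_congr rfl fun i _ => by linear_combination c * (x - B)⁻¹ * hPQ i
  rw [hfac, Matrix.det_mul, Matrix.det_diagonal, Matrix.det_one_sub_mul_comm,
    Matrix.det_fin_two, hd, prod_ite_val_lt hmn]
  simp only [Matrix.sub_apply, h00, h01, h10, h11, Matrix.one_apply]
  congr 1
  simp
  field_simp

open Polynomial in
lemma charpoly_blockModel {n m : ℕ} (hm : 1 ≤ m) (hmn : m < n) (z : Fin n → ℂ)
    (A B c e l₁ l₂ : ℝ) (hsum : l₁ + l₂ = A + (B + e * nsqLast m z))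
    (hprod : l₁ * l₂ = A * (B + e * nsqLast m z) - c ^ 2 * nsqFirst m z * nsqLast m z) :
    (blockModel m z A B c e).charpoly =
      (X - C (A : ℂ)) ^ (m - 1) * (X - C (B : ℂ)) ^ (n - m - 1)
        * ((X - C (l₁ : ℂ)) * (X - C (l₂ : ℂ))) := by
  refine Polynomial.eq_of_infinite_eval_eq _ _ ?_
  refine (Set.Finite.infinite_compl (Set.toFinite {(A : ℂ), (B : ℂ)})).mono fun x hx => ?_
  simp only [Set.mem_compl_iff, Set.mem_insert_iff, Set.mem_singleton_iff, not_or] at hx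
  have hA : x - A ≠ 0 := sub_ne_zero.2 hx.1
  have hB : x - B ≠ 0 := sub_ne_zero.2 hx.2
  have hs : (l₁ + l₂ : ℂ) = A + (B + e * nsqLast m z) := by exact_mod_cast hsum
  have hp : (l₁ * l₂ : ℂ) = A * (B + e * nsqLast m z) - c ^ 2 * nsqFirst m z * nsqLast m z := by
    exact_mod_cast hprod
  simp only [Set.mem_ofPred_eq, Matrix.eval_charpoly, det_sub_blockModel hmn.le z A B c e x hA hB,
    eval_mul, eval_pow, eval_sub, eval_X, eval_C]
  obtain ⟨k, rfl⟩ : ∃ k, m = k + 1 := ⟨m - 1, by omega⟩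
  obtain ⟨l, rfl⟩ : ∃ l, n = k + 1 + (l + 1) := ⟨n - (k + 1) - 1, by omega⟩
  simp only [Nat.add_sub_cancel_left, Nat.add_sub_cancel, pow_succ]
  field_simp
  linear_combination x * hs - hp

lemma eigMultiset_blockModel {n m : ℕ} (hm : 1 ≤ m) (hmn : m < n) (z : Fin n → ℂ)
    (A B c e l₁ l₂ : ℝ) (hsum : l₁ + l₂ = A + (B + e * nsqLast m z))
    (hprod : l₁ * l₂ = A * (B + e * nsqLast m z) - c ^ 2 * nsqFirst m z * nsqLast m z) :
    eigMultiset (blockModel m z A B c e) =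
      Multiset.replicate (m - 1) A + Multiset.replicate (n - m - 1) B + {l₁, l₂} := by
  have hH := blockModel_isHermitian m z A B c e
  rw [eigMultiset, dif_pos hH]
  apply Multiset.map_injective Complex.ofReal_injective
  have h := hH.roots_charpoly_eq_eigenvalues
  rw [← Multiset.map_map] at h
  refine h.symm.trans ?_
  rw [charpoly_blockModel hm hmn z A B c e l₁ l₂ hsum hprod,
    ← Polynomial.roots_multiset_prod_X_sub_C (Multiset.map Complex.ofReal _)]
  congr 1
  simp
  ring

/-- For `1 ≤ m < n`, `β > 0`, `u(z',z'') = (1+|z'|²)|z''|^{2β}` and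
`φ(z) = (1/2)[|z''|² + β²(1+|z'|²) + √((|z''|² + β²(1+|z'|²))² − 4β²|z''|²)]`, at every
`z ∉ N = {z'' = 0}` the complex Hessian of `u` is Hermitian and its multiset of
eigenvalues (with multiplicity) is: `|z''|^{2β}` with multiplicity `m−1`;
`β(1+|z'|²)|z''|^{2β−2}` with multiplicity `n−m−1`; `φ(z)|z''|^{2β−2}`; and
`(β²/φ(z))|z''|^{2β}`. -/
theorem pogorelov_hessian_eigenvalues (n m : ℕ) (hm : 1 ≤ m) (hmn : m < n)
    (β : ℝ) (hβ : 0 < β) :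
    ∀ z ∉ singSet n m,
      (complexHessian (pogorelov (n := n) m β) z).IsHermitian ∧
      eigMultiset (complexHessian (pogorelov (n := n) m β) z)
        = Multiset.replicate (m - 1) (Real.sqrt (nsqLast m z) ^ (2 * β))
          + Multiset.replicate (n - m - 1)
              (β * (1 + nsqFirst m z) * Real.sqrt (nsqLast m z) ^ (2 * β - 2))
          + {((nsqLast m z + β ^ 2 * (1 + nsqFirst m z)
                + Real.sqrt ((nsqLast m z + β ^ 2 * (1 + nsqFirst m z)) ^ 2
                    - 4 * β ^ 2 * nsqLast m z)) / 2)
              * Real.sqrt (nsqLast m z) ^ (2 * β - 2),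
             (β ^ 2 / ((nsqLast m z + β ^ 2 * (1 + nsqFirst m z)
                + Real.sqrt ((nsqLast m z + β ^ 2 * (1 + nsqFirst m z)) ^ 2
                    - 4 * β ^ 2 * nsqLast m z)) / 2))
              * Real.sqrt (nsqLast m z) ^ (2 * β)} := by
  intro z hz
  have hs := nsqLast_pos hz
  have ha := nsqFirst_nonneg m z
  rw [complexHessian_pogorelov β hs]
  refine ⟨blockModel_isHermitian _ _ _ _ _ _, ?_⟩
  have hexp : (2 * β - 2 : ℝ) = 2 * (β - 1) := by ring
  rw [hexp, sqrt_rpow_two_mul hs.le, sqrt_rpow_two_mul hs.le]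
  set a := nsqFirst m z with ha_def
  set s := nsqLast m z with hs_def
  have h1 : s ^ β = s ^ (β - 1) * s := by
    rw [← Real.rpow_add_one hs.ne']; ring_nf
  have h2 : s ^ (β - 2) * s = s ^ (β - 1) := by
    rw [← Real.rpow_add_one hs.ne']; ring_nf
  set T := s + β ^ 2 * (1 + a) with hT
  have hTpos : 0 < T := by positivity
  have hdisc : 0 ≤ T ^ 2 - 4 * β ^ 2 * s := by
    have hle : s + β ^ 2 ≤ T := by
      rw [hT]; nlinarith [mul_nonneg (sq_nonneg β) ha]
    have hsq : (s + β ^ 2) ^ 2 ≤ T ^ 2 := by gcongr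
    nlinarith [sq_nonneg (s - β ^ 2)]
  set R := Real.sqrt (T ^ 2 - 4 * β ^ 2 * s) with hR
  have hRsq : R ^ 2 = T ^ 2 - 4 * β ^ 2 * s := Real.sq_sqrt hdisc
  have hφ : (T + R) / 2 ≠ 0 := by
    have : 0 ≤ R := Real.sqrt_nonneg _
    positivity
  have hconj : β ^ 2 / ((T + R) / 2) * s = (T - R) / 2 := by
    rw [div_mul_eq_mul_div, div_eq_iff hφ]
    linear_combination (1 / 4) * hRsq
  have hl₂ : β ^ 2 / ((T + R) / 2) * s ^ β = (T - R) / 2 * s ^ (β - 1) := by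
    rw [h1, ← hconj]; ring
  have hB : β * (1 + a) * s ^ (β - 1) = (1 + a) * (β * s ^ (β - 1)) := by ring
  rw [hl₂, hB]
  refine eigMultiset_blockModel hm hmn z _ _ _ _ _ _ ?_ ?_
  · rw [← hs_def, h1]
    linear_combination s ^ (β - 1) * hT - (1 + a) * β * (β - 1) * h2
  · rw [← hs_def, ← ha_def, h1]
    have : (1 + a) * (β * s ^ (β - 1)) + (1 + a) * (β * ((β - 1) * s ^ (β - 2))) * s
        = (1 + a) * β ^ 2 * s ^ (β - 1) := by
      linear_combination (1 + a) * β * (β - 1) * h2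
    rw [this]
    linear_combination (-(s ^ (β - 1)) ^ 2 / 4) * hRsq
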